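/- The 988 × 988 matrix GS([B1], [B2], [B3], [B4]) built by substituting the circulant matrices [B1], [B2], [B3], [B4] into the Goethals–Seidel array is a skew-Hadamard matrix of order 988; that is, all its entries are ±1, it satisfies M · Mᵀ = 988 · I_988, and M + Mᵀ = 2 · I_988. -/

import Mathlib

open Finset Matrix

/-- The subgroup H of order 9 of the multiplicative group of `ZMod 247`. -/
def H : Finset (ZMod 247) := {1, 9, 16, 55, 61, 81, 139, 144, 235}

/-- Representatives of the even-indexed orbits. -/
def rep : List (ZMod 247) := [1, 2, 3, 5, 6, 7, 10, 11, 13, 14, 17, 19, 33, 35, 38]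

/-- The orbits `α i`: `α (2*i) = rep[i] • H` and `α (2*i+1) = -α (2*i)`. -/
def alpha (i : ℕ) : Finset (ZMod 247) :=
  if i % 2 = 0 then H.image (fun h => rep.getD (i / 2) 0 * h)
  else (H.image (fun h => rep.getD (i / 2) 0 * h)).image (fun x => -x)

def B1 : Finset (ZMod 247) := ({0, 3, 5, 7, 8, 11, 12, 15, 17, 18, 21, 22, 24, 27, 29} : Finset ℕ).biUnion alpha
def B2 : Finset (ZMod 247) := ({3, 5, 6, 8, 11, 13, 14, 15, 16, 19, 26, 27, 29} : Finset ℕ).biUnion alpha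
def B3 : Finset (ZMod 247) := ({0, 1, 2, 4, 5, 7, 11, 13, 14, 15, 22, 23, 24, 26, 27} : Finset ℕ).biUnion alpha
def B4 : Finset (ZMod 247) := ({0, 3, 8, 9, 10, 11, 13, 17, 19, 24, 25, 27, 28, 29} : Finset ℕ).biUnion alpha

/-- The circulant {±1}-matrix `[X]` associated to `X ⊆ ZMod 247`. -/
def circ (X : Finset (ZMod 247)) : Matrix (ZMod 247) (ZMod 247) ℤ :=
  Matrix.of fun i j => if j - i ∈ X then -1 else 1

/-- The back-diagonal permutation matrix `R`. -/
def R : Matrix (ZMod 247) (ZMod 247) ℤ :=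
  Matrix.of fun i j => if i + j = (246 : ZMod 247) then 1 else 0

/-- The Goethals–Seidel array. -/
def GS (P1 P2 P3 P4 : Matrix (ZMod 247) (ZMod 247) ℤ) :
    Matrix (Fin 4 × ZMod 247) (Fin 4 × ZMod 247) ℤ :=
  Matrix.of fun p q =>
    (![![P1, P2 * R, P3 * R, P4 * R],
       ![-(P2 * R), P1, -(P4ᵀ * R), P3ᵀ * R],
       ![-(P3 * R), P4ᵀ * R, P1, -(P2ᵀ * R)],
       ![-(P4 * R), -(P3ᵀ * R), P2ᵀ * R, P1]] p.1 q.1) p.2 q.2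

/-- The index sets of the orbits making up `B1, …, B4`. -/
def indexSet : Fin 4 → Finset ℕ :=
  ![{0, 3, 5, 7, 8, 11, 12, 15, 17, 18, 21, 22, 24, 27, 29},
    {3, 5, 6, 8, 11, 13, 14, 15, 16, 19, 26, 27, 29},
    {0, 1, 2, 4, 5, 7, 11, 13, 14, 15, 22, 23, 24, 26, 27},
    {0, 3, 8, 9, 10, 11, 13, 17, 19, 24, 25, 27, 28, 29}]

/-- The sets `B1, …, B4`, numbered from `0`. -/
def blockSet (k : Fin 4) : Finset (ZMod 247) := (indexSet k).biUnion alpha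

/-- The `x`-th bit of `bitMask k` tells whether `x` lies in `blockSet k`. -/
def bitMask : Fin 4 → ℕ :=
  ![94722407301435329911947095724297822495440806385864603168648713505912505938,
    87805208903860918232083646574043587096042594895012468134299878140940429424,
    165149100515261184222846157001986855387988174531584039579033607513612065310,
    63048531903880129656324535199438684402091374957986015243755897688947786690]

/-- The number of `x < 247` at which the bits `x` and `x + s` (modulo `247`) of `b` differ. -/
def disagreements (b s : ℕ) : ℕ :=
  Nat.count (fun x => b.testBit x ≠ b.testBit ((x + s) % 247)) 247

theorem exists_mem_alpha : ∀ x : ZMod 247, x ≠ 0 → ∃ i < 30, x ∈ alpha i := by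
  decide +kernel

theorem testBit_bitMask_of_mem_alpha : ∀ i < 30, ∀ x ∈ alpha i, x ≠ 0 ∧
    ∀ k, ((bitMask k).testBit x.val ↔ i ∈ indexSet k) := by
  decide +kernel

theorem lt_of_mem_indexSet : ∀ k, ∀ i ∈ indexSet k, i < 30 := by
  decide +kernel

theorem testBit_bitMask_zero : ∀ k, (bitMask k).testBit 0 = false := by
  decide +kernel

theorem testBit_bitMask_nine_mul :
    ∀ k, ∀ x : ZMod 247, (bitMask k).testBit (9 * x).val = (bitMask k).testBit x.val := by
  decide +kernel

theorem testBit_bitMask_neg : ∀ x : ZMod 247, x ≠ 0 →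
    (bitMask 0).testBit (-x).val = !(bitMask 0).testBit x.val := by
  decide +kernel

theorem exists_eq_pow_of_mem_H : ∀ h ∈ H, ∃ n < 9, h = 9 ^ n := by
  decide +kernel

theorem rep_getD_mem : ∀ i < 30, rep.getD (i / 2) 0 ∈ rep := by
  decide +kernel

theorem sum_disagreements : ∀ r ∈ rep, ∑ k, disagreements (bitMask k) r.val = 494 := by
  decide +kernel

theorem mem_blockSet_iff (k : Fin 4) (x : ZMod 247) :
    x ∈ blockSet k ↔ (bitMask k).testBit x.val := by
  simp only [blockSet, mem_biUnion]
  constructor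
  · rintro ⟨i, hi, hx⟩
    exact ((testBit_bitMask_of_mem_alpha i (lt_of_mem_indexSet k i hi) x hx).2 k).2 hi
  · intro h
    by_cases hx : x = 0
    · rw [hx, ZMod.val_zero, testBit_bitMask_zero] at h
      contradiction
    · obtain ⟨i, hi, hxi⟩ := exists_mem_alpha x hx
      exact ⟨i, ((testBit_bitMask_of_mem_alpha i hi x hxi).2 k).1 h, hxi⟩

/-- The first row of the circulant matrix of `blockSet k`. -/
def signSeq (k : Fin 4) (x : ZMod 247) : ℤ := if (bitMask k).testBit x.val then -1 else 1

theorem signSeq_eq_one_or (k : Fin 4) (x : ZMod 247) : signSeq k x = 1 ∨ signSeq k x = -1 := by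
  unfold signSeq; split_ifs <;> simp

theorem signSeq_nine_mul (k : Fin 4) (x : ZMod 247) : signSeq k (9 * x) = signSeq k x := by
  simp only [signSeq, testBit_bitMask_nine_mul]

theorem circ_blockSet_apply (k : Fin 4) (i j : ZMod 247) :
    circ (blockSet k) i j = signSeq k (j - i) := by
  simp [circ, signSeq, mem_blockSet_iff]

/-- The sum of the periodic autocorrelations of the four sign sequences. -/
def autocorr (s : ZMod 247) : ℤ := ∑ k, ∑ x, signSeq k x * signSeq k (x + s)

theorem autocorr_zero : autocorr 0 = 988 := by
  have h (k : Fin 4) (x : ZMod 247) : signSeq k x * signSeq k x = 1 := by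
    rcases signSeq_eq_one_or k x with h | h <;> simp [h]
  simp [autocorr, h, ZMod.card]

theorem autocorr_neg (s : ZMod 247) : autocorr (-s) = autocorr s := by
  refine Finset.sum_congr rfl fun k _ => ?_
  rw [← Equiv.sum_comp (Equiv.addRight s)]
  simp [mul_comm]

theorem autocorr_nine_mul (s : ZMod 247) : autocorr (9 * s) = autocorr s := by
  have h9 : (9 : ZMod 247) * 55 = 1 := by decide
  refine Finset.sum_congr rfl fun k _ => ?_
  rw [← Equiv.sum_comp (Units.mulLeft (Units.mkOfMulEqOne (9 : ZMod 247) 55 h9))]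
  simp [← mul_add, signSeq_nine_mul]

theorem autocorr_nine_pow_mul (n : ℕ) (s : ZMod 247) : autocorr (9 ^ n * s) = autocorr s := by
  induction n with
  | zero => simp
  | succ n ih => rw [pow_succ', mul_assoc, autocorr_nine_mul, ih]

theorem sum_signSeq_mul_eq (k : Fin 4) (s : ZMod 247) :
    ∑ x, signSeq k x * signSeq k (x + s) = 247 - 2 * (disagreements (bitMask k) s.val : ℤ) := by
  have h (x : ZMod 247) : signSeq k x * signSeq k (x + s) = 1 - 2 *
      (if (bitMask k).testBit x.val ≠ (bitMask k).testBit ((x.val + s.val) % 247)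
        then 1 else 0 : ℤ) := by
    unfold signSeq
    rw [ZMod.val_add]
    cases (bitMask k).testBit x.val <;>
      cases (bitMask k).testBit ((x.val + s.val) % 247) <;> simp
  simp only [h, Finset.sum_sub_distrib, ← Finset.mul_sum]
  have hc := Fin.sum_univ_eq_sum_range (fun x : ℕ =>
    (if (bitMask k).testBit x ≠ (bitMask k).testBit ((x + s.val) % 247) then 1 else 0 : ℤ)) 247
  rw [disagreements, Nat.count_eq_card_filter_range, Finset.card_filter]
  push_cast
  rw [← hc]
  simp only [Finset.sum_const, Finset.card_univ, ZMod.card]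
  rfl

theorem autocorr_of_mem_rep {r : ZMod 247} (hr : r ∈ rep) : autocorr r = 0 := by
  have h : (∑ k, (disagreements (bitMask k) r.val : ℤ)) = 494 := mod_cast sum_disagreements r hr
  simp [autocorr, sum_signSeq_mul_eq, Finset.sum_sub_distrib, ← Finset.mul_sum, h]

theorem autocorr_of_ne_zero {s : ZMod 247} (hs : s ≠ 0) : autocorr s = 0 := by
  obtain ⟨i, hi, hsi⟩ := exists_mem_alpha s hs
  have key (h : ZMod 247) (hh : h ∈ H) : autocorr (rep.getD (i / 2) 0 * h) = 0 := by
    obtain ⟨n, -, rfl⟩ := exists_eq_pow_of_mem_H h hh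
    rw [mul_comm, autocorr_nine_pow_mul, autocorr_of_mem_rep (rep_getD_mem i hi)]
  unfold alpha at hsi
  split_ifs at hsi
  · obtain ⟨h, hh, rfl⟩ := Finset.mem_image.1 hsi
    exact key h hh
  · obtain ⟨x, hx, rfl⟩ := Finset.mem_image.1 hsi
    obtain ⟨h, hh, rfl⟩ := Finset.mem_image.1 hx
    rw [autocorr_neg, key h hh]

theorem circ_eq_circulant (X : Finset (ZMod 247)) :
    circ X = circulant fun x => if -x ∈ X then -1 else 1 := by
  ext i j
  simp [circ, circulant_apply]

theorem circ_transpose_eq_circulant (X : Finset (ZMod 247)) :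
    (circ X)ᵀ = circulant fun x => if x ∈ X then -1 else 1 := by
  ext i j
  simp [circ, circulant_apply]

theorem circ_mul_comm (X Y : Finset (ZMod 247)) : circ X * circ Y = circ Y * circ X := by
  simp only [circ_eq_circulant, circulant_mul_comm]

theorem circ_transpose_mul_comm (X Y : Finset (ZMod 247)) :
    (circ X)ᵀ * circ Y = circ Y * (circ X)ᵀ := by
  rw [circ_transpose_eq_circulant, circ_eq_circulant, circulant_mul_comm]

theorem mul_R_apply (P : Matrix (ZMod 247) (ZMod 247) ℤ) (i j : ZMod 247) :
    (P * R) i j = P i (246 - j) := by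
  simp [Matrix.mul_apply, R, ← eq_sub_iff_add_eq]

theorem R_mul_apply (P : Matrix (ZMod 247) (ZMod 247) ℤ) (i j : ZMod 247) :
    (R * P) i j = P (246 - i) j := by
  simp [Matrix.mul_apply, R, ← eq_sub_iff_add_eq']

theorem R_transpose : Rᵀ = R := by
  ext i j
  simp [R, add_comm]

theorem R_mul_R : R * R = 1 := by
  ext i j
  rw [mul_R_apply]
  simp only [R, Matrix.of_apply, Matrix.one_apply]
  congr 1
  rw [add_sub_left_comm, add_eq_left, sub_eq_zero]

theorem R_mul_circ (X : Finset (ZMod 247)) : R * circ X = (circ X)ᵀ * R := by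
  ext i j
  rw [R_mul_apply, mul_R_apply]
  simp only [circ, Matrix.transpose_apply, Matrix.of_apply]
  congr 2
  ring

theorem R_mul_circ_transpose (X : Finset (ZMod 247)) : R * (circ X)ᵀ = circ X * R := by
  ext i j
  rw [R_mul_apply, mul_R_apply]
  simp only [circ, Matrix.transpose_apply, Matrix.of_apply]
  congr 2
  ring

theorem sum_circ_mul_transpose :
    circ B1 * (circ B1)ᵀ + circ B2 * (circ B2)ᵀ + circ B3 * (circ B3)ᵀ + circ B4 * (circ B4)ᵀ =
      (988 : ℤ) • 1 := by
  have h : ∑ k, circ (blockSet k) * (circ (blockSet k))ᵀ = (988 : ℤ) • 1 := by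
    ext i j
    have hij : (∑ k, circ (blockSet k) * (circ (blockSet k))ᵀ) i j = autocorr (i - j) := by
      rw [Matrix.sum_apply]
      refine Finset.sum_congr rfl fun k _ => ?_
      rw [Matrix.mul_apply, ← Equiv.sum_comp (Equiv.addRight i)]
      simp [circ_blockSet_apply, add_sub_assoc]
    rw [hij]
    by_cases hne : i = j
    · simp [hne, autocorr_zero]
    · simp [hne, autocorr_of_ne_zero (sub_ne_zero.2 hne)]
  rw [Fin.sum_univ_four] at h
  exact h

theorem circ_B1_add_transpose : circ B1 + (circ B1)ᵀ = (2 : ℤ) • 1 := by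
  change circ (blockSet 0) + (circ (blockSet 0))ᵀ = _
  ext i j
  simp only [Matrix.add_apply, Matrix.transpose_apply, circ_blockSet_apply]
  by_cases hne : i = j
  · simp only [hne, sub_self, signSeq, ZMod.val_zero, testBit_bitMask_zero]
    simp
  · rw [← neg_sub j i]
    simp only [signSeq, testBit_bitMask_neg _ (sub_ne_zero.2 (Ne.symm hne))]
    cases (bitMask 0).testBit (j - i).val <;> simp [hne]

theorem circ_mul_R_symm (X : Finset (ZMod 247)) : (circ X * R)ᵀ = circ X * R := by
  rw [Matrix.transpose_mul, R_transpose, R_mul_circ_transpose]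

theorem circ_transpose_mul_R_symm (X : Finset (ZMod 247)) :
    ((circ X)ᵀ * R)ᵀ = (circ X)ᵀ * R := by
  rw [Matrix.transpose_mul, R_transpose, Matrix.transpose_transpose, R_mul_circ]

/-- A matrix all of whose entries are `±1`. -/
def IsSignMatrix (P : Matrix (ZMod 247) (ZMod 247) ℤ) : Prop :=
  ∀ i j, P i j = 1 ∨ P i j = -1

theorem isSignMatrix_circ (X : Finset (ZMod 247)) : IsSignMatrix (circ X) := by
  intro i j
  simp only [circ, Matrix.of_apply]
  split_ifs <;> simp

theorem IsSignMatrix.transpose {P : Matrix (ZMod 247) (ZMod 247) ℤ} (h : IsSignMatrix P) :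
    IsSignMatrix Pᵀ :=
  fun i j => h j i

theorem isSignMatrix_neg_iff {P : Matrix (ZMod 247) (ZMod 247) ℤ} :
    IsSignMatrix (-P) ↔ IsSignMatrix P := by
  simp [IsSignMatrix, neg_eq_iff_eq_neg, or_comm]

theorem IsSignMatrix.mul_R {P : Matrix (ZMod 247) (ZMod 247) ℤ} (h : IsSignMatrix P) :
    IsSignMatrix (P * R) := by
  intro i j
  rw [mul_R_apply]
  exact h _ _

/-- The blocks of the Goethals–Seidel array `GS`. -/
def GSBlock (P1 P2 P3 P4 : Matrix (ZMod 247) (ZMod 247) ℤ) :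
    Fin 4 → Fin 4 → Matrix (ZMod 247) (ZMod 247) ℤ :=
  ![![P1, P2 * R, P3 * R, P4 * R],
    ![-(P2 * R), P1, -(P4ᵀ * R), P3ᵀ * R],
    ![-(P3 * R), P4ᵀ * R, P1, -(P2ᵀ * R)],
    ![-(P4 * R), -(P3ᵀ * R), P2ᵀ * R, P1]]

theorem smul_one_apply_prod (c : ℤ) (p q : Fin 4 × ZMod 247) :
    (c • 1 : Matrix (Fin 4 × ZMod 247) (Fin 4 × ZMod 247) ℤ) p q =
      (if p.1 = q.1 then c • 1 else 0 : Matrix (ZMod 247) (ZMod 247) ℤ) p.2 q.2 := by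
  by_cases h : p.1 = q.1 <;> simp [Matrix.one_apply, Prod.ext_iff, h]

theorem GS_circ_eq_one_or (X1 X2 X3 X4 : Finset (ZMod 247)) (p q : Fin 4 × ZMod 247) :
    GS (circ X1) (circ X2) (circ X3) (circ X4) p q = 1 ∨
      GS (circ X1) (circ X2) (circ X3) (circ X4) p q = -1 := by
  have key (a b : Fin 4) : IsSignMatrix (GSBlock (circ X1) (circ X2) (circ X3) (circ X4) a b) := by
    fin_cases a <;> fin_cases b <;>
      simp [GSBlock, isSignMatrix_circ, IsSignMatrix.transpose, isSignMatrix_neg_iff,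
        IsSignMatrix.mul_R]
  exact key p.1 q.1 p.2 q.2

theorem GS_circ_add_transpose {X1 : Finset (ZMod 247)} (X2 X3 X4 : Finset (ZMod 247))
    (h : circ X1 + (circ X1)ᵀ = (2 : ℤ) • 1) :
    GS (circ X1) (circ X2) (circ X3) (circ X4) + (GS (circ X1) (circ X2) (circ X3) (circ X4))ᵀ =
      (2 : ℤ) • 1 := by
  have key (a b : Fin 4) :
      GSBlock (circ X1) (circ X2) (circ X3) (circ X4) a b +
        (GSBlock (circ X1) (circ X2) (circ X3) (circ X4) b a)ᵀ =
          if a = b then (2 : ℤ) • 1 else 0 := by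
    fin_cases a <;> fin_cases b <;>
      simp [GSBlock, h, circ_mul_R_symm, circ_transpose_mul_R_symm, -transpose_mul]
  ext p q
  rw [smul_one_apply_prod, ← key]
  rfl

theorem GS_circ_mul_transpose {X1 X2 X3 X4 : Finset (ZMod 247)} {c : ℤ}
    (h : circ X1 * (circ X1)ᵀ + circ X2 * (circ X2)ᵀ + circ X3 * (circ X3)ᵀ +
      circ X4 * (circ X4)ᵀ = c • 1) :
    GS (circ X1) (circ X2) (circ X3) (circ X4) * (GS (circ X1) (circ X2) (circ X3) (circ X4))ᵀ =
      c • 1 := by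
  have hRR (P : Matrix (ZMod 247) (ZMod 247) ℤ) : P * R * R = P := by
    rw [Matrix.mul_assoc, R_mul_R, Matrix.mul_one]
  have hR (P : Matrix (ZMod 247) (ZMod 247) ℤ) (X : Finset (ZMod 247)) :
      P * R * circ X = P * (circ X)ᵀ * R := by
    rw [Matrix.mul_assoc, R_mul_circ, Matrix.mul_assoc]
  have hRt (P : Matrix (ZMod 247) (ZMod 247) ℤ) (X : Finset (ZMod 247)) :
      P * R * (circ X)ᵀ = P * circ X * R := by
    rw [Matrix.mul_assoc, R_mul_circ_transpose, Matrix.mul_assoc]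
  have hcomm (X Y : Finset (ZMod 247)) :
      (circ X)ᵀ * (circ Y)ᵀ = (circ Y)ᵀ * (circ X)ᵀ := by
    rw [← Matrix.transpose_mul, circ_mul_comm, Matrix.transpose_mul]
  have key (a b : Fin 4) :
      ∑ d, GSBlock (circ X1) (circ X2) (circ X3) (circ X4) a d *
        (GSBlock (circ X1) (circ X2) (circ X3) (circ X4) b d)ᵀ = if a = b then c • 1 else 0 := by
    rw [← h]
    fin_cases a <;> fin_cases b <;>
      simp [GSBlock, Fin.sum_univ_four, circ_mul_R_symm, circ_transpose_mul_R_symm, -transpose_mul,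
        ← Matrix.mul_assoc, hRR, hR, hRt, circ_transpose_mul_comm, circ_mul_comm X2 X1,
        circ_mul_comm X3 X1, circ_mul_comm X4 X1, circ_mul_comm X3 X2, circ_mul_comm X4 X2,
        circ_mul_comm X4 X3, hcomm X3 X2, hcomm X4 X2, hcomm X4 X3] <;>
      abel
  ext p q
  rw [smul_one_apply_prod, ← key, Matrix.mul_apply, Fintype.sum_prod_type, Matrix.sum_apply]
  rfl

theorem gs_skew_hadamard_B :
    (∀ p q, GS (circ B1) (circ B2) (circ B3) (circ B4) p q = 1 ∨
            GS (circ B1) (circ B2) (circ B3) (circ B4) p q = -1) ∧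
    GS (circ B1) (circ B2) (circ B3) (circ B4) *
      (GS (circ B1) (circ B2) (circ B3) (circ B4))ᵀ = (988 : ℤ) • 1 ∧
    GS (circ B1) (circ B2) (circ B3) (circ B4) +
      (GS (circ B1) (circ B2) (circ B3) (circ B4))ᵀ = (2 : ℤ) • 1 :=
  ⟨GS_circ_eq_one_or B1 B2 B3 B4, GS_circ_mul_transpose sum_circ_mul_transpose,
    GS_circ_add_transpose B2 B3 B4 circ_B1_add_transpose⟩
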